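/- Let d ≥ 1 and let γ, c ∈ ℚ[t] be polynomials of degree exactly d whose leading coefficients a_d, b_d satisfy a_d ≠ 0, b_d ≠ 0, and a_d ≠ b_d. Define the critical orbit sequence a : ℕ → ℚ[t] by a_0 = γ and a_{n+1} = (a_n − γ)² + c, and suppose that a_n is squarefree in ℚ[t] for every n with 1 ≤ n ≤ 16. Then the quadratic polynomial φ_{(γ,c)}(x) = (x − γ)² + c over K = ℚ(t) has surjective arboreal representation: for every n ≥ 1, the splitting field K_n of φ_{(γ,c)}^n over ℚ(t) satisfies [K_n : ℚ(t)] = 2^{2^n − 1}. -/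

import Mathlib

open Polynomial

/-- The `n`-fold iterate `φ^n` of a polynomial under composition (`φ^0 = x`). -/
noncomputable def polyIter {R : Type*} [CommRing R] (φ : Polynomial R) : ℕ → Polynomial R
  | 0 => Polynomial.X
  | n + 1 => φ.comp (polyIter φ n)


lemma exists_sqfree_decomp (n : ℕ) : ∀ A : ℚ[X], A.natDegree = n → A ≠ 0 →
    ∃ D y : ℚ[X], A = D * y ^ 2 ∧ Squarefree D := by
  induction n using Nat.strong_induction_on with
  | _ n ih =>
    intro A hA hA0
    by_cases hs : Squarefree A
    · exact ⟨A, 1, by simp, hs⟩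
    · unfold Squarefree at hs
      push Not at hs
      obtain ⟨x, ⟨B, hB⟩, hx⟩ := hs
      have hB0 : B ≠ 0 := by rintro rfl; simp at hB; exact hA0 hB
      have hx0 : x ≠ 0 := by rintro rfl; simp at hB; exact hA0 hB
      have hxd : 0 < x.natDegree := by
        by_contra h
        push Not at h
        exact hx (Polynomial.isUnit_iff_degree_eq_zero.2 (by
          rw [Polynomial.degree_eq_natDegree hx0]; simp; omega))
      have hdeg : A.natDegree = x.natDegree + x.natDegree + B.natDegree := by
        rw [hB, natDegree_mul (mul_ne_zero hx0 hx0) hB0, natDegree_mul hx0 hx0]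
      obtain ⟨D, y, h1, h2⟩ := ih B.natDegree (by omega) B rfl hB0
      exact ⟨D, x * y, by rw [hB, h1]; ring, h2⟩

lemma sqfree_dvd_of_mul_sq {D B y z : ℚ[X]} (hD : Squarefree D) (hy : y ≠ 0)
    (h : D * B * y ^ 2 = z ^ 2) : D ∣ B := by
  have hyz : y ∣ z := by
    refine (IsIntegrallyClosed.pow_dvd_pow_iff two_ne_zero).1 ?_
    exact ⟨D * B, by rw [← h]; ring⟩
  obtain ⟨w, rfl⟩ := hyz
  have h2 : D * B = w ^ 2 := by
    have : y ^ 2 ≠ 0 := pow_ne_zero _ hy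
    apply mul_right_cancel₀ this
    rw [h]; ring
  have h3 : D ∣ w := (hD.dvd_pow_iff_dvd two_ne_zero).1 ⟨B, h2.symm⟩
  obtain ⟨u, rfl⟩ := h3
  have hD0 : D ≠ 0 := hD.ne_zero
  refine ⟨u ^ 2, mul_left_cancel₀ hD0 ?_⟩
  rw [h2]; ring

section orbit
variable {d : ℕ} (hd : 1 ≤ d) {γ c : ℚ[X]}
    (hγd : γ.natDegree = d) (hcd : c.natDegree = d)
    (hγ0 : γ.coeff d ≠ 0) (hc0 : c.coeff d ≠ 0) (hne : γ.coeff d ≠ c.coeff d)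
    {a : ℕ → ℚ[X]} (h0 : a 0 = γ)
    (hrec : ∀ n, a (n + 1) = (a n - γ) ^ 2 + c)

/-- the orbit of zero -/
noncomputable def zorb (γ c : ℚ[X]) (n : ℕ) : ℚ[X] := (fun x => (x - γ) ^ 2 + c)^[n] 0

lemma zorb_succ (γ c : ℚ[X]) (n : ℕ) : zorb γ c (n+1) = (zorb γ c n - γ) ^ 2 + c := by
  unfold zorb; rw [Function.iterate_succ_apply']

lemma natDegree_sq_add {x c : ℚ[X]} {m d : ℕ} (hx : x.natDegree = m) (hc : c.natDegree = d)
    (h : d < 2 * m) : (x ^ 2 + c).natDegree = 2 * m := by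
  rw [natDegree_add_eq_left_of_natDegree_lt] <;> rw [natDegree_pow, hx]
  omega

include hd hγd hcd in
lemma zorb_deg (n : ℕ) : (zorb γ c (n + 1)).natDegree = 2 ^ (n + 1) * d := by
  induction n with
  | zero =>
    rw [zorb_succ, natDegree_sq_add (m := d) (d := d) _ hcd (by omega)]
    · ring
    · simp [zorb, hγd]
  | succ n ih =>
    have hp : 0 < 2 ^ n := by positivity
    have : d < 2 ^ (n + 1) * d := by rw [pow_succ]; nlinarith
    rw [zorb_succ, natDegree_sq_add (m := 2 ^ (n+1) * d) (d := d) _ hcd (by omega)]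
    · ring
    · rw [natDegree_sub_eq_left_of_natDegree_lt, ih]
      omega

include hd hγd hcd hne h0 hrec in
lemma orb_deg (n : ℕ) : (a (n + 1)).natDegree = 2 ^ n * d ∧ (a (n + 1) - γ).natDegree = 2 ^ n * d := by
  induction n with
  | zero =>
    have : a 1 = c := by rw [hrec, h0]; simp
    rw [zero_add, this]
    simp only [pow_zero, one_mul]
    refine ⟨hcd, natDegree_eq_of_le_of_coeff_ne_zero ?_ ?_⟩
    · exact (natDegree_sub_le _ _).trans (by simp [hγd, hcd])
    · rw [coeff_sub, sub_ne_zero]; exact hne.symm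
  | succ n ih =>
    have hp : 0 < 2 ^ n := by positivity
    have h1 : (a (n + 1 + 1)).natDegree = 2 ^ (n+1) * d := by
      rw [hrec, natDegree_sq_add ih.2 hcd (by nlinarith)]; ring
    refine ⟨h1, ?_⟩
    rw [natDegree_sub_eq_left_of_natDegree_lt, h1]
    rw [h1, hγd, pow_succ]; nlinarith

include hrec in
lemma orb_dvd (m k : ℕ) : a m ∣ a (m + k) - zorb γ c k := by
  induction k with
  | zero => simp [zorb]
  | succ k ih =>
    rw [← add_assoc, hrec, zorb_succ]
    refine ih.trans ⟨(a (m+k) - γ) + (zorb γ c k - γ), by ring⟩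

include hrec in
lemma dvd_swap {D : ℚ[X]} {N : ℕ} (hD : D ∣ a N) (S : Finset ℕ) (hS : ∀ k ∈ S, k ≤ N) :
    ∀ Y, D ∣ Y * ∏ k ∈ S, a (N - k) → D ∣ Y * ∏ k ∈ S, zorb γ c k := by
  classical
  induction S using Finset.induction_on with
  | empty => simp
  | insert k S hk ih =>
    intro Y h
    rw [Finset.prod_insert hk] at h ⊢
    obtain ⟨q, hq⟩ := orb_dvd hrec (N - k) k
    rw [Nat.sub_add_cancel (hS k (by simp))] at hq
    have h1 := ih (fun k hk => hS k (by simp [hk])) (Y * a (N - k)) (by rw [mul_assoc]; exact h)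
    have h2 : Y * (zorb γ c k * ∏ k ∈ S, zorb γ c k) =
      (Y * ∏ k ∈ S, zorb γ c k) * a N - (Y * a (N-k) * ∏ k ∈ S, zorb γ c k) * q := by
      have : zorb γ c k = a N - a (N - k) * q := by rw [← hq]; ring
      rw [this]; ring
    rw [h2]
    exact dvd_sub (hD.mul_left _) (h1.mul_right _)

include hd hγd hcd hne h0 hrec in
lemma prod_orb_deg (n : ℕ) : (∏ m ∈ Finset.range n, a (m+1)).natDegree = (2 ^ n - 1) * d := by
  have hne0 : ∀ m, a (m+1) ≠ 0 := by
    intro m h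
    have := (orb_deg hd hγd hcd hne h0 hrec m).1
    rw [h] at this
    have hp : 0 < 2 ^ m * d := by positivity
    simp at this; omega
  rw [natDegree_prod _ _ (fun i _ => hne0 i)]
  rw [Finset.sum_congr rfl (fun i _ => (orb_deg hd hγd hcd hne h0 hrec i).1)]
  rw [← Finset.sum_mul, Nat.geomSum_eq (le_refl 2)]; simp

include hd hγd hcd hne h0 hrec in
lemma orb_ne_zero (m : ℕ) : a (m+1) ≠ 0 := by
    intro h
    have := (orb_deg hd hγd hcd hne h0 hrec m).1
    rw [h] at this
    have hp : 0 < 2 ^ m * d := by positivity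
    simp at this; omega

/-- bound on the degree of a squarefree D -/
lemma zorb_deg_aux (hd : 1 ≤ d) (hγd : γ.natDegree = d) (hcd : c.natDegree = d) :
    (∏ k ∈ Finset.Icc 1 5, zorb γ c k) ≠ 0 ∧
    (∏ k ∈ Finset.Icc 1 5, zorb γ c k).natDegree = 62 * d := by
  have hk : ∀ k ∈ Finset.Icc 1 5, (zorb γ c k).natDegree = 2 ^ k * d := by
    intro k hk
    obtain ⟨j, rfl⟩ : ∃ j, k = j + 1 := ⟨k - 1, by simp at hk; omega⟩
    exact zorb_deg hd hγd hcd j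
  have hk0 : ∀ k ∈ Finset.Icc 1 5, zorb γ c k ≠ 0 := by
    intro k hk' h
    have := hk k hk'
    rw [h] at this
    have hp : 0 < 2 ^ k * d := by positivity
    simp at this; omega
  refine ⟨Finset.prod_ne_zero_iff.2 hk0, ?_⟩
  rw [natDegree_prod _ _ hk0, Finset.sum_congr rfl hk, ← Finset.sum_mul]
  rfl

include hd hγd hcd hne h0 hrec in
lemma D_bound {D : ℚ[X]} {M : ℕ} (hD : D ∣ a (M + 6))
    (hB : D ∣ ∏ m ∈ Finset.range (M + 5), a (m+1)) : D.natDegree ≤ (2 ^ M - 1 + 62) * d := by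
  have hsplit : ∏ m ∈ Finset.range (M + 5), a (m+1) =
     (∏ m ∈ Finset.range M, a (m+1)) * ∏ k ∈ Finset.Icc 1 5, a (M + 6 - k) := by
    rw [Finset.prod_range_add]
    congr 1
    have : Finset.Icc 1 5 = {1,2,3,4,5} := rfl
    rw [this]
    simp [Finset.prod_range_succ]
    ring
  rw [hsplit] at hB
  have h1 := dvd_swap hrec hD (Finset.Icc 1 5) (by simp; omega) _ hB
  obtain ⟨hz, hz'⟩ := zorb_deg_aux (γ := γ) (c := c) hd hγd hcd
  have hp : (∏ m ∈ Finset.range M, a (m+1)) ≠ 0 :=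
    Finset.prod_ne_zero_iff.2 (fun m _ => orb_ne_zero hd hγd hcd hne h0 hrec m)
  have := natDegree_le_of_dvd h1 (mul_ne_zero hp hz)
  rw [natDegree_mul hp hz, hz', prod_orb_deg hd hγd hcd hne h0 hrec] at this
  rw [add_mul]; exact this

lemma deriv_ne {E : ℚ[X]} {m : ℕ} (hd : 1 ≤ d) (hcd : c.natDegree = d) (hE : E.natDegree = m) (hm : d < 2 * m) :
    2 * c * derivative E - derivative c * E ≠ 0 := by
  intro h
  have h1 : (2 * m * E.leadingCoeff * c.leadingCoeff - d * E.leadingCoeff * c.leadingCoeff : ℚ) = 0 := by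
    have hc1 : (c * derivative E).coeff (d + (m - 1)) = c.leadingCoeff * (E.leadingCoeff * m) := by
      rw [coeff_mul_add_eq_of_natDegree_le hcd.le ((natDegree_derivative_le E).trans (by omega))]
      rw [coeff_derivative, leadingCoeff, leadingCoeff, hcd, hE]
      have : m - 1 + 1 = m := by omega
      rw [this]
      have : ((m - 1 : ℕ) : ℚ) + 1 = m := by exact_mod_cast this
      rw [this]
    have hc2 : (derivative c * E).coeff (d + (m - 1)) = (c.leadingCoeff * d) * E.leadingCoeff := by
      have : d + (m - 1) = (d - 1) + m := by omega
      rw [this, coeff_mul_add_eq_of_natDegree_le ((natDegree_derivative_le c).trans (by omega)) hE.le]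
      rw [coeff_derivative, leadingCoeff, leadingCoeff, hcd, hE]
      have : d - 1 + 1 = d := by omega
      rw [this]
      have : ((d - 1 : ℕ) : ℚ) + 1 = d := by exact_mod_cast this
      rw [this]
    have h2 := congrArg (fun p => coeff p (d + (m - 1))) h
    simp only [coeff_sub, coeff_zero, hc2, mul_assoc] at h2
    have h3 : ((2 : ℚ[X]) * (c * derivative E)).coeff (d + (m-1)) = 2 * (c * derivative E).coeff (d + (m-1)) := by
      rw [← C_ofNat, coeff_C_mul]
    rw [h3, hc1] at h2
    linear_combination h2
  have hE0 : E.leadingCoeff ≠ 0 := by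
    rw [leadingCoeff_ne_zero]; rintro rfl; simp at hE; omega
  have hc0 : c.leadingCoeff ≠ 0 := by
    rw [leadingCoeff_ne_zero]; rintro rfl; simp at hcd; omega
  have h4 : ((2 * m : ℚ) - d) * (E.leadingCoeff * c.leadingCoeff) = 0 := by linear_combination h1
  rcases mul_eq_zero.1 h4 with h5 | h5
  · have : (2 * m : ℚ) = d := by linarith
    have : 2 * m = d := by exact_mod_cast this
    omega
  · exact (mul_ne_zero hE0 hc0) h5

lemma deriv_deg_le {E : ℚ[X]} {m : ℕ} (hcd : c.natDegree ≤ d) (hE : E.natDegree ≤ m) :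
    (2 * c * derivative E - derivative c * E).natDegree ≤ d + m := by
  refine (natDegree_sub_le _ _).trans (max_le ?_ ?_)
  · refine natDegree_mul_le.trans ?_
    have h1 : (2 * c).natDegree ≤ c.natDegree := by
      rw [← C_ofNat]; exact natDegree_C_mul_le _ _
    have := natDegree_derivative_le E
    omega
  · refine natDegree_mul_le.trans ?_
    have := natDegree_derivative_le c
    omega

/-- key step: congruence modulo `w` forces an equality. -/
lemma key_step {D s v w E F : ℚ[X]} {m : ℕ}
    (hw : w ∣ v - E) (hw' : w ∣ derivative v - derivative E)
    (hF : F = E ^ 2 + c)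
    (hs : D * (2 * c * derivative v - derivative c * v) ^ 2 = s ^ 2 * (v ^ 2 + c))
    (hdeg1 : D.natDegree + 2 * (d + m) < w.natDegree) (hcd : c.natDegree ≤ d) (hE : E.natDegree ≤ m)
    (hdeg2 : 2 * s.natDegree + F.natDegree < w.natDegree) :
    D * (2 * c * derivative E - derivative c * E) ^ 2 = s ^ 2 * F := by
  obtain ⟨p, hp⟩ := hw
  obtain ⟨q, hq⟩ := hw'
  have hv : v = E + w * p := by rw [← hp]; ring
  have hv' : derivative v = derivative E + w * q := by rw [← hq]; ring
  have hdvd : w ∣ D * (2 * c * derivative E - derivative c * E) ^ 2 - s ^ 2 * F := by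
    rw [hv', hv] at hs
    have e : D * (2 * c * derivative E - derivative c * E) ^ 2 - s ^ 2 * F = w *
      (s ^ 2 * (2 * E * p + w * p ^ 2) - D * (2 * (2 * c * derivative E - derivative c * E) * (2 * c * q - derivative c * p) + w * (2 * c * q - derivative c * p) ^ 2)) := by
      rw [hF]
      linear_combination hs
    exact ⟨_, e⟩
  by_contra hcon
  have h1 := natDegree_le_of_dvd hdvd (sub_ne_zero.2 hcon)
  have h2 : (D * (2 * c * derivative E - derivative c * E) ^ 2).natDegree ≤ D.natDegree + 2 * (d + m) := by
    refine natDegree_mul_le.trans (Nat.add_le_add_left (natDegree_pow_le.trans ?_) _)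
    exact Nat.mul_le_mul_left _ (deriv_deg_le hcd hE)
  have h3 : (s ^ 2 * F).natDegree ≤ 2 * s.natDegree + F.natDegree :=
    natDegree_mul_le.trans (Nat.add_le_add_right natDegree_pow_le _)
  have h4 := natDegree_sub_le (D * (2 * c * derivative E - derivative c * E) ^ 2) (s ^ 2 * F)
  have := h1.trans (h4.trans (max_le_max h2 h3))
  have := this.trans_lt (max_lt hdeg1 hdeg2)
  omega

include hd hγd hcd hne h0 hrec in
lemma big_case (hsf3 : Squarefree (a 3)) {D y : ℚ[X]} {M : ℕ}
    (hM : 11 ≤ M) (hDy : a (M + 6) = D * y ^ 2) (hDd : D.natDegree ≤ (2 ^ M - 1 + 62) * d) : False := by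
  have hdeg := orb_deg hd hγd hcd hne h0 hrec
  have ha1 : a 1 = c := by rw [hrec, h0]; simp
  set e := c - γ with he
  have hed : e.natDegree = d := by have := (hdeg 0).2; rw [zero_add, ha1] at this; simpa using this
  have ha2 : a 2 = e ^ 2 + c := by rw [hrec, ha1]
  set E := e ^ 2 + e with hE
  have ha3 : a 3 = E ^ 2 + c := by rw [hrec, ha2, hE]; ring
  have hEd : E.natDegree = 2 * d := natDegree_sq_add hed hed (by omega)
  set v := a (M + 5) - γ with hv
  set u := a (M + 4) - γ with hu
  set w := a (M + 3) - γ with hw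
  have hvu : v = u ^ 2 + e := by rw [hv, hrec, hu, he]; ring
  have huw : u = w ^ 2 + e := by rw [hu, hrec, hw, he]; ring
  have hvd : v.natDegree = 2 ^ (M + 4) * d := (hdeg (M+4)).2
  have hud : u.natDegree = 2 ^ (M + 3) * d := (hdeg (M+3)).2
  have hwd : w.natDegree = 2 ^ (M + 2) * d := (hdeg (M+2)).2
  have haN : D * y ^ 2 = v ^ 2 + c := by rw [← hDy, hrec]
  have hy : y ∣ 2 * c * derivative v - derivative c * v := by
    have h1 : derivative (D * y ^ 2) = derivative (v ^ 2 + c) := by rw [haN]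
    simp only [derivative_mul, derivative_add, derivative_sq, C_ofNat] at h1
    refine ⟨2 * derivative v * D * y - v * (derivative D * y + 2 * D * derivative y), ?_⟩
    linear_combination v * h1 - 2 * derivative v * haN
  obtain ⟨s, hs⟩ := hy
  have hs2 : D * (2 * c * derivative v - derivative c * v) ^ 2 = s ^ 2 * (v ^ 2 + c) := by
    rw [hs, ← haN]; ring
  have hv0 : d < 2 * v.natDegree := by
    rw [hvd, pow_add]; have : 0 < 2 ^ M := by positivity
    nlinarith
  have hR := deriv_ne hd hcd rfl hv0
  have hs0 : s ≠ 0 := by rintro rfl; simp at hs; exact hR hs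
  have hy0 : y ≠ 0 := by rintro rfl; simp at hs; exact hR hs
  have hD0 : D ≠ 0 := by
    rintro rfl; simp at hDy; exact orb_ne_zero hd hγd hcd hne h0 hrec _ hDy
  have hdy : D.natDegree + 2 * y.natDegree = 2 ^ (M+5) * d := by
    have := (hdeg (M+5)).1
    rw [hDy, natDegree_mul hD0 (pow_ne_zero _ hy0), natDegree_pow] at this
    exact this
  have hsd : y.natDegree + s.natDegree ≤ d + 2 ^ (M+4) * d := by
    rw [← natDegree_mul hy0 hs0, ← hs]
    exact deriv_deg_le hcd.le hvd.le
  have hM' : 2048 ≤ 2 ^ M := by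
    calc 2048 = 2 ^ 11 := by norm_num
      _ ≤ 2 ^ M := Nat.pow_le_pow_right (by norm_num) hM
  have hT : 2048 * d ≤ 2 ^ M * d := Nat.mul_le_mul_right _ hM'
  have hDd' : D.natDegree + d ≤ 2 ^ M * d + 62 * d := by
    have : (2 ^ M - 1 + 62) * d + d = 2 ^ M * d + 62 * d := by
      have : 2 ^ M - 1 + 62 + 1 = 2 ^ M + 62 := by omega
      rw [← add_one_mul, this, add_mul]
    omega
  have e1 : 2 ^ (M+5) * d = 32 * (2 ^ M * d) := by ring
  have e2 : 2 ^ (M+4) * d = 16 * (2 ^ M * d) := by ring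
  have e3 : 2 ^ (M+3) * d = 8 * (2 ^ M * d) := by ring
  have e4 : 2 ^ (M+2) * d = 4 * (2 ^ M * d) := by ring
  have hd2 : (a 2).natDegree = 2 * d := by simpa using (hdeg 1).1
  have hd3 : (a 3).natDegree = 4 * d := by simpa using (hdeg 2).1
  set T := 2 ^ M * d with hTdef
  have k1 := key_step (d := d) (m := d) (D := D) (s := s) (v := v) (w := u) (E := e) (F := a 2) (c := c)
    ⟨u, by rw [hvu]; ring⟩ ⟨2 * derivative u, by rw [hvu]; simp only [derivative_add, derivative_sq, C_ofNat]; ring⟩ ha2 hs2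
    (by rw [hud, e3]; omega) hcd.le hed.le (by rw [hud, e3, hd2]; omega)
  have k2 := key_step (d := d) (m := 2 * d) (D := D) (s := s) (v := v) (w := w) (E := E) (F := a 3) (c := c)
    ⟨w * (w ^ 2 + 2 * e), by rw [hvu, huw, hE]; ring⟩
    ⟨2 * derivative w * (w ^ 2 + e) * 2 + 2 * w * derivative e, by
      rw [hvu, huw, hE]; simp only [derivative_add, derivative_sq, C_ofNat]; ring⟩ ha3 hs2
    (by rw [hwd, e4]; omega) hcd.le hEd.le (by rw [hwd, e4, hd3]; omega)
  have r1 := deriv_ne (c := c) hd hcd hed (by omega)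
  set ρ1 := 2 * c * derivative e - derivative c * e
  set ρ2 := 2 * c * derivative E - derivative c * E
  have hfin : a 3 * a 2 * (s * ρ1) ^ 2 = (s * ρ2 * a 2) ^ 2 := by
    linear_combination ρ2 ^ 2 * a 2 * k1 - ρ1 ^ 2 * a 2 * k2
  have hdvd := sqfree_dvd_of_mul_sq hsf3 (mul_ne_zero hs0 r1) hfin
  have := natDegree_le_of_dvd hdvd (orb_ne_zero hd hγd hcd hne h0 hrec 1)
  rw [hd2, hd3] at this
  omega

include hd hγd hcd hne h0 hrec in
lemma not_square_prod (hsf : ∀ n, 1 ≤ n → n ≤ 16 → Squarefree (a n))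
    (b : ℕ → ℚ[X]) (hb0 : b 0 = - a 1) (hb : ∀ n, b (n+1) = a (n+2)) (J : Finset ℕ) (hJ : J.Nonempty) :
    ¬ IsSquare (∏ j ∈ J, b j) := by
  rintro ⟨z, hz⟩
  set n := J.max' hJ with hn
  have hnJ : n ∈ J := J.max'_mem hJ
  rw [← Finset.mul_prod_erase J b hnJ] at hz
  have hbass : ∀ j, b j ∣ a (j+1) := by
    intro j
    cases j with
    | zero => rw [hb0]; simp
    | succ j => rw [hb]
  have hsub : J.erase n ⊆ Finset.range n := by
    intro j hj
    rw [Finset.mem_erase] at hj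
    rw [Finset.mem_range]
    exact lt_of_le_of_ne (J.le_max' j hj.2) hj.1
  have hBdvd : ∏ j ∈ J.erase n, b j ∣ ∏ m ∈ Finset.range n, a (m+1) :=
    (Finset.prod_dvd_prod_of_dvd _ _ (fun j _ => hbass j)).trans (Finset.prod_dvd_prod_of_subset _ _ _ hsub)
  have hpos : 0 < 2 ^ n := by positivity
  by_cases hn16 : n + 1 ≤ 16
  · have hsq : Squarefree (b n) := (hsf (n+1) (by omega) hn16).squarefree_of_dvd (hbass n)
    have h1 := sqfree_dvd_of_mul_sq (y := 1) (z := z) hsq one_ne_zero (by rw [one_pow, mul_one, hz, sq])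
    have h2 := natDegree_le_of_dvd (h1.trans hBdvd)
      (Finset.prod_ne_zero_iff.2 (fun m _ => orb_ne_zero hd hγd hcd hne h0 hrec m))
    rw [prod_orb_deg hd hγd hcd hne h0 hrec] at h2
    have h3 : (b n).natDegree = 2 ^ n * d := by
      rw [← (orb_deg hd hγd hcd hne h0 hrec n).1]
      cases n with
      | zero => rw [hb0]; simp
      | succ j => rw [hb]
    rw [h3] at h2
    have := Nat.le_of_mul_le_mul_right h2 (by omega)
    omega
  · obtain ⟨M, hM⟩ : ∃ M, n = M + 5 := ⟨n - 5, by omega⟩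
    have hbn : b n = a (M + 6) := by rw [hM, hb]
    obtain ⟨D, y, hDy, hD⟩ := exists_sqfree_decomp _ (a (M+6)) rfl (orb_ne_zero hd hγd hcd hne h0 hrec _)
    have hy0 : y ≠ 0 := by
      rintro rfl; simp at hDy; exact orb_ne_zero hd hγd hcd hne h0 hrec _ hDy
    have h1 := sqfree_dvd_of_mul_sq (y := y) (z := z) (B := ∏ j ∈ J.erase n, b j) hD hy0
      (by rw [sq z, ← hz, hbn, hDy]; ring)
    have h2 := h1.trans hBdvd
    rw [hM] at h2
    exact big_case hd hγd hcd hne h0 hrec (hsf 3 (by omega) (by omega))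
      (by omega) hDy (D_bound hd hγd hcd hne h0 hrec ⟨_, hDy⟩ h2)

end orbit

lemma exists_invariant {G Y : Type*} [Group G] [MulAction G Y] [DecidableEq Y] (R : Finset Y)
    (hR : ∀ (σ : G), ∀ x ∈ R, σ • x ∈ R)
    (hp : ∀ σ : G, ∃ k : ℕ, ∀ x ∈ R, σ ^ (2 ^ k) • x = x)
    (P : Finset Y → Prop) (hP0 : P ∅)
    (hPd : ∀ I J, I ⊆ R → J ⊆ R → P I → P J → P (symmDiff I J))
    (hPs : ∀ (σ : G) I, I ⊆ R → P I → P (I.image (fun x => σ • x)))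
    (I0 : Finset Y) (h0 : I0 ⊆ R) (h0' : I0.Nonempty) (h0P : P I0) :
    ∃ I ⊆ R, I.Nonempty ∧ P I ∧ ∀ σ : G, I.image (fun x => σ • x) = I := by
  classical
  let W := {I : Finset Y // I ⊆ R ∧ P I}
  have : Finite W := by
    have : Finite {I : Finset Y // I ∈ R.powerset} := inferInstance
    exact Finite.of_injective (β := {I : Finset Y // I ∈ R.powerset})
      (fun I => ⟨I.1, Finset.mem_powerset.2 I.2.1⟩) (fun I J h => Subtype.ext (by simpa using h))
  have : Fintype W := Fintype.ofFinite W
  let act : MulAction G W :=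
    { smul := fun σ I => ⟨I.1.image (fun x => σ • x), by
        intro y hy
        obtain ⟨x, hx, rfl⟩ := Finset.mem_image.1 hy
        exact hR σ x (I.2.1 hx), hPs σ _ I.2.1 I.2.2⟩
      one_smul := fun I => Subtype.ext (by
        change I.1.image (fun x => (1 : G) • x) = I.1
        simp)
      mul_smul := fun σ τ I => Subtype.ext (by
        change I.1.image (fun x => (σ * τ) • x) = (I.1.image (fun x => τ • x)).image (fun x => σ • x)
        rw [Finset.image_image]
        congr 1; funext x; simp [mul_smul]) }
  have hsm : ∀ (σ : G) (I : W), (σ • I).1 = I.1.image (fun x => σ • x) := fun _ _ => rfl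
  let H := (MulAction.toPermHom G W).range
  have hH : IsPGroup 2 H := by
    rintro ⟨h, σ, rfl⟩
    obtain ⟨k, hk⟩ := hp σ
    refine ⟨k, Subtype.ext ?_⟩
    change (MulAction.toPermHom G W σ) ^ (2 ^ k) = 1
    rw [← map_pow]
    ext1 I
    refine Subtype.ext ?_
    change (σ ^ (2 ^ k) • I).1 = I.1
    rw [hsm]
    conv_rhs => rw [← Finset.image_id (s := I.1)]
    exact Finset.image_congr (fun x hx => hk x (I.2.1 hx))
  have hcard : 2 ∣ Nat.card W := by
    let g : W → W := fun I => ⟨symmDiff I.1 I0, by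
      intro x hx
      rw [Finset.mem_symmDiff] at hx
      rcases hx with hx | hx
      · exact I.2.1 hx.1
      · exact h0 hx.1, hPd _ _ I.2.1 h0 I.2.2 h0P⟩
    have hg : Function.Involutive g := fun I => Subtype.ext (by
      change symmDiff (symmDiff I.1 I0) I0 = I.1
      exact symmDiff_symmDiff_cancel_right _ _)
    have h1 : (Fintype.card W) ≡ Fintype.card (Function.fixedPoints g) [MOD 2] := by
      have : Fact (Nat.Prime 2) := ⟨Nat.prime_two⟩
      refine Equiv.Perm.card_fixedPoints_modEq (f := g) (p := 2) (n := 1) ?_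
      funext I; exact hg I
    have h2 : Fintype.card (Function.fixedPoints g) = 0 := by
      rw [Fintype.card_eq_zero_iff]
      refine ⟨fun I => ?_⟩
      have h3 : symmDiff I.1.1 I0 = I.1.1 := congrArg Subtype.val I.2
      have h4 : I0 = ∅ := by
        have := symmDiff_eq_left.1 h3
        simpa using this
      exact h0'.ne_empty h4
    rw [h2] at h1
    rw [Nat.card_eq_fintype_card]
    exact (Nat.modEq_zero_iff_dvd).1 h1
  let e : W := ⟨∅, by simp, hP0⟩
  have : Fact (Nat.Prime 2) := ⟨Nat.prime_two⟩
  obtain ⟨I, hI, hne⟩ := hH.exists_fixed_point_of_prime_dvd_card_of_fixed_point W hcard (a := e) (by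
    rintro ⟨h, σ, rfl⟩
    refine Subtype.ext ?_
    change Finset.image _ ∅ = ∅
    simp)
  refine ⟨I.1, I.2.1, ?_, I.2.2, fun σ => ?_⟩
  · rw [Finset.nonempty_iff_ne_empty]
    intro h
    exact hne (Subtype.ext h.symm)
  · have := hI ⟨MulAction.toPermHom G W σ, σ, rfl⟩
    exact congrArg Subtype.val this

section kummer
variable {K Ω : Type*} [Field K] [CharZero K] [Field Ω] [Algebra K Ω]
  [Algebra.IsAlgebraic K Ω]

/-- being a square of an element of `F` -/
def SqIn (F : IntermediateField K Ω) (x : Ω) : Prop := ∃ z ∈ F, z * z = x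

open IntermediateField in
lemma mem_quad {F : IntermediateField K Ω} {r : Ω} (hr : r * r ∈ F) {x : Ω}
    (hx : x ∈ F ⊔ adjoin K {r}) : ∃ p ∈ F, ∃ q ∈ F, x = p + q * r := by
  rw [← restrictScalars_adjoin_eq_sup, mem_restrictScalars, ← mem_toSubalgebra,
    adjoin_simple_toSubalgebra_of_isAlgebraic (Algebra.IsAlgebraic.isAlgebraic (R := F) r)] at hx
  induction hx using Algebra.adjoin_induction with
  | mem x hx =>
    rw [Set.mem_singleton_iff] at hx
    exact ⟨0, F.zero_mem, 1, F.one_mem, by simp [hx]⟩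
  | algebraMap y => exact ⟨y, y.2, 0, F.zero_mem, by simp⟩
  | add x y _ _ h1 h2 =>
    obtain ⟨p, hp, q, hq, rfl⟩ := h1
    obtain ⟨p', hp', q', hq', rfl⟩ := h2
    exact ⟨p + p', F.add_mem hp hp', q + q', F.add_mem hq hq', by ring⟩
  | mul x y _ _ h1 h2 =>
    obtain ⟨p, hp, q, hq, rfl⟩ := h1
    obtain ⟨p', hp', q', hq', rfl⟩ := h2
    exact ⟨p * p' + q * q' * (r * r), F.add_mem (F.mul_mem hp hp') (F.mul_mem (F.mul_mem hq hq') hr),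
      p * q' + q * p', F.add_mem (F.mul_mem hp hq') (F.mul_mem hq hp'), by ring⟩

open IntermediateField in
lemma quad_step {F : IntermediateField K Ω} {r : Ω} (hr : r * r ∈ F) {x : Ω} (hx : x ∈ F)
    (h : SqIn (F ⊔ adjoin K {r}) x) : SqIn F x ∨ SqIn F (x * (r * r)) := by
  obtain ⟨z, hz, rfl⟩ := h
  obtain ⟨p, hp, q, hq, rfl⟩ := mem_quad hr hz
  by_cases hrF : r ∈ F
  · exact Or.inl ⟨_, F.add_mem hp (F.mul_mem hq hrF), rfl⟩
  have : CharZero Ω := charZero_of_injective_algebraMap (algebraMap K Ω).injective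
  by_cases hpq : 2 * p * q = 0
  · rcases mul_eq_zero.1 hpq with h | h
    · have hp0 : p = 0 := by simpa using h
      right
      exact ⟨q * (r * r), F.mul_mem hq hr, by rw [hp0]; ring⟩
    · left
      exact ⟨p, hp, by rw [h]; ring⟩
  · exfalso
    apply hrF
    have h2 : (2 : Ω) ∈ F := by simp
    have hk : 2 * p * q ∈ F := F.mul_mem (F.mul_mem h2 hp) hq
    have : r = ((p + q * r) * (p + q * r) - (p * p + q * q * (r * r))) / (2 * p * q) := by
      rw [eq_div_iff hpq]; ring
    rw [this]
    exact F.div_mem (F.sub_mem hx (F.add_mem (F.mul_mem hp hp) (F.mul_mem (F.mul_mem hq hq) hr))) hk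

open IntermediateField in
lemma quad_deg {F : IntermediateField K Ω} {r : Ω} (hr : r * r ∈ F) (hrF : r ∉ F) :
    Module.finrank K ↥(F ⊔ adjoin K {r}) = Module.finrank K F * 2 := by
  have hintegral : IsIntegral F r := (Algebra.IsAlgebraic.isAlgebraic (R := F) r).isIntegral
  have h1 : Module.finrank F F⟮r⟯ = 2 := by
    rw [adjoin.finrank hintegral]
    apply le_antisymm
    · have hd : minpoly F r ∣ X ^ 2 - C (⟨r * r, hr⟩ : F) := by
        apply minpoly.dvd
        simp [sq]
      have := natDegree_le_of_dvd hd (X_pow_sub_C_ne_zero (by norm_num) _)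
      rwa [natDegree_X_pow_sub_C] at this
    · rw [minpoly.two_le_natDegree_iff hintegral]
      rintro ⟨y, rfl⟩
      exact hrF y.2
  rw [← restrictScalars_adjoin_eq_sup, ← h1]
  exact (Module.finrank_mul_finrank K F F⟮r⟯).symm

variable {ι : Type*} {r f : ι → Ω}

open IntermediateField in
lemma sup_adjoin_insert [DecidableEq ι] (F : IntermediateField K Ω) (β : ι) (S : Finset ι) :
    F ⊔ adjoin K (r '' (insert β S : Finset ι)) = (F ⊔ adjoin K (r '' S)) ⊔ adjoin K {r β} := by
  rw [Finset.coe_insert, Set.image_insert_eq, Set.insert_eq, adjoin_union, sup_assoc,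
    sup_comm (adjoin K {r β})]

open IntermediateField in
lemma kummer_sq [DecidableEq ι] (F : IntermediateField K Ω) (S : Finset ι)
    (hf : ∀ β ∈ S, r β * r β = f β ∧ f β ∈ F) :
    ∀ x ∈ F, SqIn (F ⊔ adjoin K (r '' S)) x → ∃ I ⊆ S, SqIn F (x * ∏ β ∈ I, f β) := by
  induction S using Finset.induction_on with
  | empty =>
    intro x hx h
    refine ⟨∅, by simp, ?_⟩
    simpa using h
  | insert β S hβ ih =>
    intro x hx h
    rw [sup_adjoin_insert] at h
    have ih' := ih (fun b hb => hf b (Finset.mem_insert_of_mem hb))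
    obtain ⟨hb1, hb2⟩ := hf β (Finset.mem_insert_self _ _)
    have hle : F ≤ F ⊔ adjoin K (r '' S) := le_sup_left
    rcases quad_step (by rw [hb1]; exact hle hb2) (hle hx) h with h | h
    · obtain ⟨I, hI, hs⟩ := ih' x hx h
      exact ⟨I, hI.trans (Finset.subset_insert _ _), hs⟩
    · rw [hb1] at h
      obtain ⟨I, hI, hs⟩ := ih' _ (F.mul_mem hx hb2) h
      refine ⟨insert β I, Finset.insert_subset_insert _ hI, ?_⟩
      rw [Finset.prod_insert (fun h => hβ (hI h)), ← mul_assoc]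
      exact hs

open IntermediateField in
lemma kummer_deg [DecidableEq ι] (F : IntermediateField K Ω) (S : Finset ι)
    (hf : ∀ β ∈ S, r β * r β = f β ∧ f β ∈ F)
    (hind : ∀ I ⊆ S, SqIn F (∏ β ∈ I, f β) → I = ∅) :
    Module.finrank K ↥(F ⊔ adjoin K (r '' S)) = Module.finrank K F * 2 ^ S.card := by
  induction S using Finset.induction_on with
  | empty =>
    have : F ⊔ adjoin K (r '' ((∅ : Finset ι) : Set ι)) = F := by simp
    rw [this]; simp
  | insert β S hβ ih =>
    have hf' := (fun b hb => hf b (Finset.mem_insert_of_mem hb))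
    have ih' := ih hf' (fun I hI => hind I (hI.trans (Finset.subset_insert _ _)))
    obtain ⟨hb1, hb2⟩ := hf β (Finset.mem_insert_self _ _)
    have hle : F ≤ F ⊔ adjoin K (r '' S) := le_sup_left
    rw [sup_adjoin_insert, quad_deg (by rw [hb1]; exact hle hb2), ih', Finset.card_insert_of_notMem hβ]
    · ring
    · intro hmem
      obtain ⟨I, hI, hs⟩ := kummer_sq F S hf' (f β) hb2 ⟨_, hmem, hb1⟩
      rw [← Finset.prod_insert (fun h => hβ (hI h))] at hs
      have := hind _ (Finset.insert_subset_insert _ hI) hs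
      simp at this

end kummer

section arboreal

/-- a chosen square root -/
noncomputable def rt {Ω : Type*} [Field Ω] [IsAlgClosed Ω] (x : Ω) : Ω :=
  Classical.choose (IsAlgClosed.exists_eq_mul_self x)

lemma rt_mul {Ω : Type*} [Field Ω] [IsAlgClosed Ω] (x : Ω) : rt x * rt x = x :=
  (Classical.choose_spec (IsAlgClosed.exists_eq_mul_self x)).symm

/-- the quadratic map -/
def qmap {R : Type*} [CommRing R] (g c : R) (x : R) : R := (x - g) ^ 2 + c

open Classical in
/-- the `n`-th preimages of zero -/
noncomputable def Rset {Ω : Type*} [Field Ω] [IsAlgClosed Ω] (g c : Ω) : ℕ → Finset Ω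
  | 0 => {0}
  | n + 1 => (Rset g c n).biUnion (fun β => {g + rt (β - c), g - rt (β - c)})

section basic
variable {Ω : Type*} [Field Ω] [IsAlgClosed Ω] (g c : Ω)

lemma mem_fiber (x β : Ω) : (x = g + rt (β - c) ∨ x = g - rt (β - c)) ↔ qmap g c x = β := by
  have h := rt_mul (β - c)
  set r := rt (β - c)
  have : qmap g c x - β = (x - (g + r)) * (x - (g - r)) := by
    unfold qmap
    linear_combination h
  rw [← sub_eq_zero (a := qmap g c x), this, mul_eq_zero, sub_eq_zero, sub_eq_zero]

lemma mem_Rset_succ (n : ℕ) (x : Ω) : x ∈ Rset g c (n+1) ↔ qmap g c x ∈ Rset g c n := by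
  classical
  simp only [Rset, Finset.mem_biUnion, Finset.mem_insert, Finset.mem_singleton, mem_fiber]
  constructor
  · rintro ⟨β, hβ, rfl⟩; exact hβ
  · intro h; exact ⟨_, h, rfl⟩

lemma mem_Rset (n : ℕ) : ∀ x : Ω, x ∈ Rset g c n ↔ (qmap g c)^[n] x = 0 := by
  induction n with
  | zero => intro x; simp [Rset]
  | succ n ih => intro x; rw [mem_Rset_succ, ih, Function.iterate_succ_apply]

lemma rset_facts [CharZero Ω] (hc : ∀ n, (qmap g c)^[n] c ≠ 0) (n : ℕ) :
    (Rset g c n).card = 2 ^ n ∧ ∀ z, ∏ β ∈ Rset g c n, (z - β) = (qmap g c)^[n] z := by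
  classical
  induction n with
  | zero => simp [Rset]
  | succ n ih =>
    have hdis : Set.PairwiseDisjoint (Rset g c n : Set Ω)
        (fun β => ({g + rt (β - c), g - rt (β - c)} : Finset Ω)) := by
      intro β _ β' _ hne
      rw [Function.onFun, Finset.disjoint_left]
      intro x hx hx'
      simp only [Finset.mem_insert, Finset.mem_singleton, mem_fiber] at hx hx'
      exact hne (hx.symm.trans hx')
    have hne : ∀ β ∈ Rset g c n, g + rt (β - c) ≠ g - rt (β - c) := by
      intro β hβ h
      have h2 : 2 * rt (β - c) = 0 := by linear_combination h
      have h3 : rt (β - c) = 0 := by simpa using h2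
      have h4 := rt_mul (β - c)
      rw [h3] at h4
      have h5 : β = c := by linear_combination -h4
      rw [mem_Rset, h5] at hβ
      exact hc n hβ
    constructor
    · rw [Rset, Finset.card_biUnion hdis, Finset.sum_congr rfl (fun β hβ => Finset.card_pair (hne β hβ))]
      rw [Finset.sum_const, ih.1]; simp [pow_succ]
    · intro z
      rw [Rset, Finset.prod_biUnion hdis, Function.iterate_succ_apply, ← ih.2]
      refine Finset.prod_congr rfl (fun β hβ => ?_)
      rw [Finset.prod_pair (hne β hβ)]
      have h := rt_mul (β - c)
      unfold qmap
      linear_combination -h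
end basic

variable {K Ω : Type*} [Field K] [CharZero K] [Field Ω] [Algebra K Ω]
  [IsAlgClosed Ω] [Algebra.IsAlgebraic K Ω] (γ c : K)

local notation "gg" => algebraMap K Ω γ
local notation "cc" => algebraMap K Ω c

lemma map_qmap (σ : Ω ≃ₐ[K] Ω) (x : Ω) : σ (qmap gg cc x) = qmap gg cc (σ x) := by
  simp [qmap]

lemma map_Rset (σ : Ω ≃ₐ[K] Ω) (n : ℕ) : ∀ x ∈ Rset gg cc n, σ x ∈ Rset gg cc n := by
  induction n with
  | zero => intro x hx; simp [Rset] at hx ⊢; exact hx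
  | succ n ih =>
    intro x hx
    rw [mem_Rset_succ] at hx ⊢
    rw [← map_qmap]; exact ih _ hx

lemma pow_fix (σ : Ω ≃ₐ[K] Ω) (n : ℕ) : ∀ x ∈ Rset gg cc n, (σ ^ (2 ^ n)) x = x := by
  induction n with
  | zero => intro x hx; simp [Rset] at hx; simp [hx]
  | succ n ih =>
    intro x hx
    rw [mem_Rset_succ] at hx
    have h1 := ih _ hx
    set τ := σ ^ (2 ^ n) with hτ
    have h2 : σ ^ (2 ^ (n+1)) = τ * τ := by rw [hτ, ← pow_add]; congr 1; ring
    rw [h2, AlgEquiv.mul_apply]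
    rw [map_qmap] at h1
    have h3 : (τ x - x) * (τ x + x - 2 * gg) = 0 := by
      unfold qmap at h1; linear_combination h1
    rcases mul_eq_zero.1 h3 with h | h
    · have : τ x = x := by linear_combination h
      rw [this, this]
    · have : τ x = 2 * gg - x := by linear_combination h
      rw [this, map_sub, map_mul, map_ofNat, AlgEquiv.commutes, this]; ring

/-- the field generated by the `n`-th preimages -/
noncomputable def Kf (Ω : Type*) [Field Ω] [Algebra K Ω] [IsAlgClosed Ω] (γ c : K) (n : ℕ) : IntermediateField K Ω :=
  IntermediateField.adjoin K (Rset (algebraMap K Ω γ) (algebraMap K Ω c) n : Set Ω)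

lemma Rset_sub_Kf {n : ℕ} {x : Ω} (hx : x ∈ Rset gg cc n) : x ∈ Kf Ω γ c n :=
  IntermediateField.subset_adjoin _ _ hx

lemma map_Kf (σ : Ω ≃ₐ[K] Ω) (n : ℕ) {x : Ω} (hx : x ∈ Kf Ω γ c n) : σ x ∈ Kf Ω γ c n := by
  have h1 : (Kf Ω γ c n).map (σ : Ω →ₐ[K] Ω) ≤ Kf Ω γ c n := by
    unfold Kf
    rw [IntermediateField.adjoin_map]
    apply IntermediateField.adjoin.mono
    rintro _ ⟨y, hy, rfl⟩
    exact map_Rset γ c σ n y hy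
  exact h1 ⟨x, hx, rfl⟩

lemma Kf_succ (n : ℕ) : Kf Ω γ c (n+1) = Kf Ω γ c n ⊔
    IntermediateField.adjoin K ((fun β => rt (β - cc)) '' (Rset gg cc n : Set Ω)) := by
  apply le_antisymm
  · unfold Kf
    rw [IntermediateField.adjoin_le_iff]
    intro x hx
    have hx' : qmap gg cc x ∈ Rset gg cc n := (mem_Rset_succ _ _ _ _).1 hx
    have hr : rt (qmap gg cc x - cc) ∈ (IntermediateField.adjoin K (Rset gg cc n : Set Ω)) ⊔
      IntermediateField.adjoin K ((fun β => rt (β - cc)) '' (Rset gg cc n : Set Ω)) := by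
      have hle : IntermediateField.adjoin K ((fun β => rt (β - cc)) '' (Rset gg cc n : Set Ω)) ≤
        (IntermediateField.adjoin K (Rset gg cc n : Set Ω)) ⊔
        IntermediateField.adjoin K ((fun β => rt (β - cc)) '' (Rset gg cc n : Set Ω)) := le_sup_right
      exact hle (IntermediateField.subset_adjoin _ _ ⟨_, hx', rfl⟩)
    rcases (mem_fiber gg cc x _).2 rfl with h | h
    · rw [h]; exact add_mem (IntermediateField.algebraMap_mem _ γ) hr
    · rw [h]; exact sub_mem (IntermediateField.algebraMap_mem _ γ) hr
  · apply sup_le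
    · unfold Kf
      rw [IntermediateField.adjoin_le_iff]
      intro β hβ
      have h1 : gg + rt (β - cc) ∈ Rset gg cc (n+1) := by
        rw [mem_Rset_succ, (mem_fiber gg cc _ β).1 (Or.inl rfl)]; exact hβ
      have h2 := Rset_sub_Kf γ c h1
      have h3 : β = qmap gg cc (gg + rt (β - cc)) := ((mem_fiber gg cc _ β).1 (Or.inl rfl)).symm
      rw [h3]
      exact add_mem (pow_mem (sub_mem h2 (IntermediateField.algebraMap_mem _ γ)) 2) (IntermediateField.algebraMap_mem _ c)
    · rw [IntermediateField.adjoin_le_iff]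
      rintro _ ⟨β, hβ, rfl⟩
      have h1 : gg + rt (β - cc) ∈ Rset gg cc (n+1) := by
        rw [mem_Rset_succ, (mem_fiber gg cc _ β).1 (Or.inl rfl)]; exact hβ
      have h2 := sub_mem (Rset_sub_Kf γ c h1) (IntermediateField.algebraMap_mem _ γ)
      simpa [Kf] using h2

lemma sqIn_symmDiff [DecidableEq Ω] {F : IntermediateField K Ω} {f : Ω → Ω} {R : Finset Ω} (hf : ∀ β ∈ R, f β ∈ F)
    (hf0 : ∀ β ∈ R, f β ≠ 0) {I J : Finset Ω} (hI : I ⊆ R) (hJ : J ⊆ R)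
    (h : SqIn F ((∏ β ∈ I, f β) * ∏ β ∈ J, f β)) : SqIn F (∏ β ∈ symmDiff I J, f β) := by
  obtain ⟨z, hz, hzz⟩ := h
  have hIJ : I ∩ J ⊆ R := Finset.inter_subset_left.trans hI
  have hq0 : ∏ β ∈ I ∩ J, f β ≠ 0 := Finset.prod_ne_zero_iff.2 (fun β hβ => hf0 β (hIJ hβ))
  refine ⟨z / ∏ β ∈ I ∩ J, f β, F.div_mem hz (prod_mem (fun β hβ => hf β (hIJ hβ))), ?_⟩
  rw [div_mul_div_comm, hzz, div_eq_iff (mul_ne_zero hq0 hq0)]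
  rw [← Finset.prod_sdiff (Finset.inter_subset_left : I ∩ J ⊆ I),
    ← Finset.prod_sdiff (Finset.inter_subset_right : I ∩ J ⊆ J)]
  have h2 : symmDiff I J = (I \ (I ∩ J)) ∪ (J \ (I ∩ J)) := by
    ext x; simp [Finset.mem_symmDiff]
  rw [h2, Finset.prod_union]
  · ring
  · rw [Finset.disjoint_left]; intro x; simp; tauto

/-- signed critical orbit -/
def bseq (γ c : K) (n : ℕ) : K := (-1) ^ (2 ^ n) * (qmap γ c)^[n] c

lemma iter_map (n : ℕ) (x : K) : (qmap gg cc)^[n] (algebraMap K Ω x) = algebraMap K Ω ((qmap γ c)^[n] x) := by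
  induction n generalizing x with
  | zero => rfl
  | succ n ih =>
    rw [Function.iterate_succ_apply, Function.iterate_succ_apply, ← ih]
    simp [qmap]

/-- The inductive claim. -/
structure Claim (Ω : Type*) [Field Ω] [Algebra K Ω] [IsAlgClosed Ω] (γ c : K) (n : ℕ) : Prop where
  trans : ∀ x ∈ Rset (algebraMap K Ω γ) (algebraMap K Ω c) n,
    ∀ y ∈ Rset (algebraMap K Ω γ) (algebraMap K Ω c) n, ∃ σ : Ω ≃ₐ[K] Ω, σ x = y
  deg : Module.finrank K (Kf Ω γ c n) = 2 ^ (2 ^ n - 1)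
  sq : ∀ x : K, SqIn (Kf Ω γ c n) (algebraMap K Ω x) →
    ∃ J ⊆ Finset.range n, IsSquare (x * ∏ j ∈ J, bseq γ c j)

lemma claim_zero : Claim Ω γ c 0 := by
  have hK : Kf Ω γ c 0 = ⊥ := by simp [Kf, Rset]
  refine ⟨?_, ?_, ?_⟩
  · intro x hx y hy
    simp [Rset] at hx hy
    exact ⟨1, by simp [hx, hy]⟩
  · rw [hK]; simp
  · rintro x ⟨z, hz, hzz⟩
    rw [hK, IntermediateField.mem_bot] at hz
    obtain ⟨w, rfl⟩ := hz
    refine ⟨∅, by simp, w, ?_⟩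
    rw [← map_mul] at hzz
    simpa using ((algebraMap K Ω).injective hzz).symm

section step
variable (hns : ∀ J : Finset ℕ, J.Nonempty → ¬ IsSquare (∏ j ∈ J, bseq γ c j))
include hns

lemma iter_ne (n : ℕ) : (qmap gg cc)^[n] cc ≠ 0 := by
  intro h
  rw [iter_map, map_eq_zero] at h
  apply hns {n} (by simp)
  simp [bseq, h]

lemma prod_eq_b (n : ℕ) : ∏ β ∈ Rset gg cc n, (β - cc) = algebraMap K Ω (bseq γ c n) := by
  have : CharZero Ω := charZero_of_injective_algebraMap (algebraMap K Ω).injective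
  have h := rset_facts gg cc (iter_ne γ c hns) n
  have h2 : ∏ β ∈ Rset gg cc n, (β - cc) = ∏ β ∈ Rset gg cc n, ((-1) * (cc - β)) :=
    Finset.prod_congr rfl (fun β _ => by ring)
  rw [h2, Finset.prod_mul_distrib, h.2, Finset.prod_const, h.1, bseq, iter_map]
  simp

lemma sub_ne (n : ℕ) : ∀ β ∈ Rset gg cc n, β - cc ≠ 0 := by
  intro β hβ h
  rw [sub_eq_zero] at h
  rw [mem_Rset, h] at hβ
  exact iter_ne γ c hns n hβ

omit hns in
lemma sub_mem_Kf (n : ℕ) : ∀ β ∈ Rset gg cc n, β - cc ∈ Kf Ω γ c n := fun _ hβ =>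
  sub_mem (Rset_sub_Kf γ c hβ) (IntermediateField.algebraMap_mem _ c)

omit hns in
lemma invariant_all {n : ℕ} (h : Claim Ω γ c n) [DecidableEq Ω] {I : Finset Ω} (hI : I ⊆ Rset gg cc n) (hne : I.Nonempty)
    (hinv : ∀ σ : Ω ≃ₐ[K] Ω, I.image (fun x => σ x) = I) : I = Rset gg cc n := by
  refine Finset.Subset.antisymm hI (fun y hy => ?_)
  obtain ⟨x, hx⟩ := hne
  obtain ⟨σ, rfl⟩ := h.trans x (hI hx) y hy
  rw [← hinv σ]
  exact Finset.mem_image_of_mem _ hx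

omit hns in
lemma map_prod_image [DecidableEq Ω] (σ : Ω ≃ₐ[K] Ω) (I : Finset Ω) :
    ∏ β ∈ I.image (fun x => σ x), (β - cc) = σ (∏ β ∈ I, (β - cc)) := by
  rw [Finset.prod_image (fun x _ y _ h => σ.injective h), map_prod]
  exact Finset.prod_congr rfl (fun β _ => by simp)

lemma indep {n : ℕ} (h : Claim Ω γ c n) :
    ∀ I ⊆ Rset gg cc n, SqIn (Kf Ω γ c n) (∏ β ∈ I, (β - cc)) → I = ∅ := by
  classical
  intro I hI hs
  by_contra hne
  obtain ⟨I', hI', hne', hs', hinv⟩ := exists_invariant (G := Ω ≃ₐ[K] Ω) (Rset gg cc n)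
    (fun σ => map_Rset γ c σ n) (fun σ => ⟨n, pow_fix γ c σ n⟩)
    (fun I => SqIn (Kf Ω γ c n) (∏ β ∈ I, (β - cc))) ⟨1, one_mem _, by simp⟩
    (fun I J hI hJ h1 h2 => by
      apply sqIn_symmDiff (sub_mem_Kf γ c n) (sub_ne γ c hns n) hI hJ
      obtain ⟨z, hz, h1⟩ := h1
      obtain ⟨w, hw, h2⟩ := h2
      exact ⟨z * w, mul_mem hz hw, by rw [← h1, ← h2]; ring⟩)
    (fun σ I hI h1 => by
      obtain ⟨z, hz, h1⟩ := h1
      exact ⟨σ z, map_Kf γ c σ n hz, by rw [← map_mul, h1]; exact (map_prod_image c σ I).symm⟩)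
    I hI (Finset.nonempty_iff_ne_empty.2 hne) hs
  have hall := invariant_all γ c h hI' hne' hinv
  rw [hall, prod_eq_b γ c hns] at hs'
  obtain ⟨J, hJ, hsq⟩ := h.sq _ hs'
  have hnJ : n ∉ J := fun hn => by simpa using hJ hn
  rw [← Finset.prod_insert hnJ] at hsq
  exact hns _ (by simp) hsq

lemma claim_succ {n : ℕ} (h : Claim Ω γ c n) : Claim Ω γ c (n+1) := by
  classical
  have : CharZero Ω := charZero_of_injective_algebraMap (algebraMap K Ω).injective
  have hind := indep γ c hns h
  have hf : ∀ β ∈ Rset gg cc n, rt (β - cc) * rt (β - cc) = β - cc ∧ β - cc ∈ Kf Ω γ c n :=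
    fun β hβ => ⟨rt_mul _, sub_mem_Kf γ c n β hβ⟩
  refine ⟨?_, ?_, ?_⟩
  · intro x hx y hy
    rw [mem_Rset_succ] at hx hy
    obtain ⟨σ, hσ⟩ := h.trans _ hx _ hy
    rw [map_qmap] at hσ
    have h3 : (σ x - y) * (σ x + y - 2 * gg) = 0 := by
      unfold qmap at hσ; linear_combination hσ
    rcases mul_eq_zero.1 h3 with h4 | h4
    · exact ⟨σ, by linear_combination h4⟩
    · have hyK : y ∉ Kf Ω γ c n := by
        intro hyK
        have := hind {qmap gg cc y} (by simpa using hy) ⟨y - gg, sub_mem hyK (IntermediateField.algebraMap_mem _ γ), by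
          simp [qmap]; ring⟩
        simp at this
      have hac : IsAlgClosure K Ω := ⟨inferInstance, inferInstance⟩
      have hnorm : Normal K Ω := IsAlgClosure.normal K Ω
      have : IsGalois K Ω := ⟨⟩
      have hτ : ∃ τ : Ω ≃ₐ[K] Ω, (∀ z ∈ Kf Ω γ c n, τ z = z) ∧ τ y ≠ y := by
        by_contra hcon
        push Not at hcon
        apply hyK
        rw [← InfiniteGalois.fixedField_fixingSubgroup (Kf Ω γ c n), IntermediateField.mem_fixedField_iff]
        intro τ hτ
        apply hcon τ
        intro z hz
        exact (IntermediateField.mem_fixingSubgroup_iff _ _).1 hτ z hz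
      obtain ⟨τ, hτ1, hτ2⟩ := hτ
      have h5 := hτ1 _ (Rset_sub_Kf γ c hy)
      rw [map_qmap] at h5
      have h6 : (τ y - y) * (τ y + y - 2 * gg) = 0 := by
        unfold qmap at h5; linear_combination h5
      have h7 := (mul_eq_zero.1 h6).resolve_left (sub_ne_zero.2 hτ2)
      refine ⟨τ * σ, ?_⟩
      have h8 : σ x = 2 * gg - y := by linear_combination h4
      rw [AlgEquiv.mul_apply, h8]
      rw [map_sub, map_mul, map_ofNat, AlgEquiv.commutes]
      linear_combination -h7
  · rw [Kf_succ, kummer_deg _ _ hf hind, h.deg, (rset_facts gg cc (iter_ne γ c hns) n).1, ← pow_add]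
    congr 1
    have : 0 < 2 ^ n := by positivity
    rw [pow_succ]; omega
  · intro x hx
    rw [Kf_succ] at hx
    obtain ⟨I, hI, hs⟩ := kummer_sq _ _ hf _ (IntermediateField.algebraMap_mem _ x) hx
    by_cases hx0 : x = 0
    · exact ⟨∅, by simp, by simp [hx0]⟩
    have hinv : ∀ σ : Ω ≃ₐ[K] Ω, I.image (fun x => σ x) = I := by
      intro σ
      have hsub : I.image (fun x => σ x) ⊆ Rset gg cc n := by
        intro y hy
        obtain ⟨x, hx, rfl⟩ := Finset.mem_image.1 hy
        exact map_Rset γ c σ n x (hI hx)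
      have := hind (symmDiff (I.image (fun x => σ x)) I) (by
        intro y hy
        rw [Finset.mem_symmDiff] at hy
        rcases hy with hy | hy
        · exact hsub hy.1
        · exact hI hy.1) (by
        apply sqIn_symmDiff (sub_mem_Kf γ c n) (sub_ne γ c hns n) hsub hI
        obtain ⟨z, hz, h1⟩ := hs
        have hx0' : algebraMap K Ω x ≠ 0 := by simpa using hx0
        refine ⟨σ z * z / algebraMap K Ω x, div_mem (mul_mem (map_Kf γ c σ n hz) hz) (IntermediateField.algebraMap_mem _ x), ?_⟩
        have h2 := congrArg σ h1
        rw [map_mul, map_mul, AlgEquiv.commutes] at h2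
        rw [map_prod_image, div_mul_div_comm, div_eq_iff (mul_ne_zero hx0' hx0')]
        linear_combination σ z * σ z * h1 + (algebraMap K Ω x * ∏ β ∈ I, (β - cc)) * h2)
      rw [← Finset.bot_eq_empty, symmDiff_eq_bot] at this
      exact this
    rcases I.eq_empty_or_nonempty with hIe | hIe
    · rw [hIe] at hs
      obtain ⟨J, hJ, hsq⟩ := h.sq x (by simpa using hs)
      exact ⟨J, hJ.trans (by simp), hsq⟩
    · rw [invariant_all γ c h hI hIe hinv, prod_eq_b γ c hns, ← map_mul] at hs
      obtain ⟨J, hJ, hsq⟩ := h.sq _ hs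
      have hnJ : n ∉ J := fun hn => by simpa using hJ hn
      refine ⟨insert n J, ?_, ?_⟩
      · rw [Finset.range_add_one]; exact Finset.insert_subset_insert _ hJ
      · rw [Finset.prod_insert hnJ, ← mul_assoc]; exact hsq

lemma claim_all (n : ℕ) : Claim Ω γ c n := by
  induction n with
  | zero => exact claim_zero γ c
  | succ n ih => exact claim_succ γ c hns ih

end step
end arboreal

lemma polyIter_aeval {K Ω : Type*} [Field K] [Field Ω] [Algebra K Ω] (γ c : K) (n : ℕ) (x : Ω) :
    aeval x (polyIter ((X - C γ) ^ 2 + C c) n) = (qmap (algebraMap K Ω γ) (algebraMap K Ω c))^[n] x := by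
  induction n with
  | zero => simp [polyIter]
  | succ n ih =>
    rw [polyIter, aeval_comp, ih, Function.iterate_succ_apply']
    simp [qmap]

lemma polyIter_ne_zero {K : Type*} [Field K] (γ c : K) (n : ℕ) :
    (polyIter ((X - C γ) ^ 2 + C c) n).Monic ∧ (polyIter ((X - C γ) ^ 2 + C c) n).natDegree ≠ 0 := by
  have hm : ((X - C γ) ^ 2 + C c).natDegree = 2 := by compute_degree!
  have hm' : ((X - C γ) ^ 2 + C c).Monic := by
    unfold Monic leadingCoeff
    rw [hm]
    compute_degree!
  induction n with
  | zero => simp [polyIter, monic_X]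
  | succ n ih =>
    rw [polyIter]
    refine ⟨hm'.comp ih.1 ih.2, ?_⟩
    rw [natDegree_comp, hm]
    simpa using ih.2

lemma finrank_splitting {K : Type*} [Field K] (γ c : K) (n : ℕ) :
    Module.finrank K (polyIter ((X - C γ) ^ 2 + C c) n).SplittingField =
      Module.finrank K (Kf (AlgebraicClosure K) γ c n) := by
  set p := polyIter ((X - C γ) ^ 2 + C c) n with hp
  have hp0 : p ≠ 0 := (polyIter_ne_zero γ c n).1.ne_zero
  have hroot : (Rset (algebraMap K (AlgebraicClosure K) γ) (algebraMap K (AlgebraicClosure K) c) n : Set (AlgebraicClosure K))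
      = p.rootSet (AlgebraicClosure K) := by
    ext x
    rw [Finset.mem_coe, mem_Rset, mem_rootSet, hp, polyIter_aeval]
    exact ⟨fun h => ⟨hp0, h⟩, fun h => h.2⟩
  unfold Kf
  rw [hroot]
  have : p.IsSplittingField K (IntermediateField.adjoin K (p.rootSet (AlgebraicClosure K))) :=
    IntermediateField.adjoin_rootSet_isSplittingField (IsAlgClosed.splits _)
  exact (IsSplittingField.algEquiv (IntermediateField.adjoin K (p.rootSet (AlgebraicClosure K))) p).toLinearEquiv.finrank_eq.symm

lemma isSquare_of_ratFunc {p : ℚ[X]} (h : IsSquare (algebraMap ℚ[X] (RatFunc ℚ) p)) : IsSquare p := by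
  obtain ⟨z, hz⟩ := h
  have hintegral : IsIntegral ℚ[X] z := by
    refine ⟨X ^ 2 - C p, monic_X_pow_sub_C _ (by norm_num), ?_⟩
    simp [hz, sq]
  obtain ⟨y, rfl⟩ := IsIntegrallyClosed.isIntegral_iff.1 hintegral
  refine ⟨y, IsFractionRing.injective ℚ[X] (RatFunc ℚ) ?_⟩
  rw [hz, map_mul]

/-- Surjectivity of the arboreal representation. -/
theorem stmt_13 (d : ℕ) (hd : 1 ≤ d) (γ c : Polynomial ℚ)
    (hγd : γ.natDegree = d) (hcd : c.natDegree = d)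
    (hγ0 : γ.coeff d ≠ 0) (hc0 : c.coeff d ≠ 0) (hne : γ.coeff d ≠ c.coeff d)
    (a : ℕ → Polynomial ℚ) (h0 : a 0 = γ)
    (hrec : ∀ n, a (n + 1) = (a n - γ) ^ 2 + c)
    (hsf : ∀ n, 1 ≤ n → n ≤ 16 → Squarefree (a n)) :
    ∀ n : ℕ, 1 ≤ n →
      Module.finrank (RatFunc ℚ)
        ((polyIter
          ((X - C (algebraMap (Polynomial ℚ) (RatFunc ℚ) γ)) ^ 2
            + C (algebraMap (Polynomial ℚ) (RatFunc ℚ) c)) n).SplittingField)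
      = 2 ^ (2 ^ n - 1) := by
  intro n _
  rw [finrank_splitting]
  refine (claim_all _ _ ?_ n).deg
  have horb : ∀ k, (qmap (algebraMap ℚ[X] (RatFunc ℚ) γ) (algebraMap ℚ[X] (RatFunc ℚ) c))^[k]
      (algebraMap ℚ[X] (RatFunc ℚ) c) = algebraMap ℚ[X] (RatFunc ℚ) (a (k+1)) := by
    intro k
    induction k with
    | zero => simp [hrec, h0]
    | succ k ih => rw [Function.iterate_succ_apply', ih, hrec (k+1)]; simp [qmap]
  have hb : ∀ k, bseq (algebraMap ℚ[X] (RatFunc ℚ) γ) (algebraMap ℚ[X] (RatFunc ℚ) c) k =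
      algebraMap ℚ[X] (RatFunc ℚ) ((-1) ^ (2 ^ k) * a (k+1)) := by
    intro k
    rw [bseq, horb]; simp
  intro J hJ hsq
  simp only [hb] at hsq
  rw [← map_prod] at hsq
  refine not_square_prod hd hγd hcd hne h0 hrec hsf (fun k => (-1) ^ (2 ^ k) * a (k+1)) (by simp) ?_ J hJ
    (isSquare_of_ratFunc hsq)
  intro n
  have : Even (2 ^ (n+1)) := ⟨2 ^ n, by ring⟩
  simp [this.neg_one_pow]
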